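/- Let E be an equivalence relation on ℕ^ℕ with K ⊆ E, and let T and S be Laver trees such that [T] is contained in a single E-equivalence class and [S] is contained in a single E-equivalence class. Then these two equivalence classes coincide, i.e., every element of [T] is E-equivalent to every element of [S]. -/

import Mathlib

open Set Filter

/-- The restriction of `x : ℕ → ℕ` to `{0,…,n-1}`, as a finite sequence. -/
def seg (x : ℕ → ℕ) (n : ℕ) : List ℕ := List.ofFn fun i : Fin n => x i

/-- `s` is the stem of the tree `T`: it belongs to `T`, is comparable with every
element of `T`, and every node of `T` extending it splits infinitely. -/
def IsStemOf (T : Set (List ℕ)) (s : List ℕ) : Prop :=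
  s ∈ T ∧ (∀ t ∈ T, t <+: s ∨ s <+: t) ∧
    ∀ t ∈ T, s <+: t → {n : ℕ | t ++ [n] ∈ T}.Infinite

/-- A Laver tree: closed under initial segments, with a stem. -/
def IsLaverTree (T : Set (List ℕ)) : Prop :=
  (∀ s ∈ T, ∀ t : List ℕ, t <+: s → t ∈ T) ∧ ∃ s, IsStemOf T s

/-- `[T]`, the set of branches of `T`. -/
def branches (T : Set (List ℕ)) : Set (ℕ → ℕ) := {x | ∀ n, seg x n ∈ T}

/-- `S ≤₀ T`: `S` is a Laver tree included in `T` with the same stem. -/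
def DirectExt (S T : Set (List ℕ)) : Prop :=
  IsLaverTree S ∧ S ⊆ T ∧ ∃ s, IsStemOf S s ∧ IsStemOf T s

/-- An (proper, containing all finite sets) ideal on ℕ. -/
def IsIdeal (I : Set (Set ℕ)) : Prop :=
  (∀ A : Set ℕ, A.Finite → A ∈ I) ∧ (∀ A B : Set ℕ, A ⊆ B → B ∈ I → A ∈ I) ∧
    (∀ A B : Set ℕ, A ∈ I → B ∈ I → A ∪ B ∈ I) ∧ (Set.univ : Set ℕ) ∉ I

/-- A P-ideal. -/
def IsPIdeal (I : Set (Set ℕ)) : Prop :=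
  ∀ A : ℕ → Set ℕ, (∀ n, A n ∈ I) → ∃ B ∈ I, ∀ n, (A n \ B).Finite

/-- Characteristic function of a subset of ℕ, as a point of the Cantor space. -/
noncomputable def chi (A : Set ℕ) : ℕ → Bool :=
  fun n => @decide (n ∈ A) (Classical.propDecidable _)

/-- An F_σ set: a countable union of closed sets. -/
def IsFsigma {X : Type*} [TopologicalSpace X] (A : Set X) : Prop :=
  ∃ F : ℕ → Set X, (∀ n, IsClosed (F n)) ∧ A = ⋃ n, F n

/-- An ideal on ℕ is F_σ if its copy in the Cantor space `ℕ → Bool` is F_σ. -/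
def FsigmaIdeal (I : Set (Set ℕ)) : Prop := IsFsigma (chi '' I)

/-- The equivalence relation `E_I` on the Cantor space induced by an ideal `I`. -/
def EI (I : Set (Set ℕ)) (x y : ℕ → Bool) : Prop := {n | x n ≠ y n} ∈ I

/-- The generator `A_g` of the Laver ideal. -/
def laverGen (g : List ℕ → ℕ) : Set (ℕ → ℕ) := {f | {n | f n < g (seg f n)}.Infinite}

/-- Membership in the Laver ideal: covered by countably many generators. -/
def InLaverIdeal (A : Set (ℕ → ℕ)) : Prop :=
  ∃ g : ℕ → List ℕ → ℕ, A ⊆ ⋃ i, laverGen (g i)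

/-- The relation `K` on the Baire space. -/
def Krel (x y : ℕ → ℕ) : Prop :=
  ∃ b : ℕ, ∀ n : ℕ, ∃ mx ≤ b, ∃ my ≤ b, x n ≤ y (n + my) ∧ y n ≤ x (n + mx)

/-- `E_{ℓ∞}` on `ℝ^ℕ`: the difference sequence is bounded. -/
def Elinf (x y : ℕ → ℝ) : Prop := ∃ C : ℝ, ∀ n, |x n - y n| ≤ C

/-- A lower semicontinuous submeasure on ℕ. -/
def IsLSCSubmeasure (μ : Set ℕ → ENNReal) : Prop :=
  μ ∅ = 0 ∧ (∀ A B : Set ℕ, A ⊆ B → μ A ≤ μ B) ∧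
    (∀ A B : Set ℕ, μ (A ∪ B) ≤ μ A + μ B) ∧
    ∀ A : Set ℕ, μ A = ⨆ n : ℕ, μ (A ∩ Set.Iio n)

/-- `Exh(μ)`. -/
def Exh (μ : Set ℕ → ENNReal) : Set (Set ℕ) :=
  {A | Filter.Tendsto (fun n : ℕ => μ (A \ Set.Iio n)) Filter.atTop (nhds 0)}

/-- `Fin(μ)`. -/
def FinSub (μ : Set ℕ → ENNReal) : Set (Set ℕ) := {A | μ A < ⊤}

theorem seg_succ (x : ℕ → ℕ) (n : ℕ) : seg x (n + 1) = seg x n ++ [x n] := by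
  simp only [seg, List.ofFn_succ_last, Fin.val_castSucc, Fin.val_last]

theorem apply_mem_seg (x : ℕ → ℕ) {i n : ℕ} (h : i < n) : x i ∈ seg x n :=
  List.mem_ofFn.2 ⟨⟨i, h⟩, rfl⟩

theorem seg_isPrefix (x : ℕ → ℕ) {m n : ℕ} (h : m ≤ n) : seg x m <+: seg x n := by
  induction n, h using Nat.le_induction with
  | base => exact List.prefix_rfl
  | succ n _ ih => exact ih.trans ⟨[x n], (seg_succ x n).symm⟩

/-- Above its stem, a node of a Laver tree has a successor bounding any given finite list. -/
theorem IsStemOf.exists_succ_ge {T : Set (List ℕ)} {s t : List ℕ} (hs : IsStemOf T s)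
    (ht : t ∈ T) (hst : s <+: t) (l : List ℕ) : ∃ k, t ++ [k] ∈ T ∧ ∀ z ∈ l, z ≤ k := by
  obtain ⟨k, hk, hlt⟩ := (hs.2.2 t ht hst).exists_gt l.sum
  exact ⟨k, hk, fun z hz => (List.le_sum_of_mem hz).trans hlt.le⟩

/-- A chain of nodes, each an immediate successor of the previous one, traces out a branch. -/
theorem exists_branch_of_chain {T : Set (List ℕ)}
    (hT : ∀ s ∈ T, ∀ t : List ℕ, t <+: s → t ∈ T) (p : ℕ → List ℕ) (k : ℕ → ℕ)
    (hp : ∀ n, p n ∈ T) (hk : ∀ n, p (n + 1) = p n ++ [k n]) :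
    ∃ x ∈ branches T, (∀ n, p n = seg x ((p 0).length + n)) ∧
      ∀ n, x ((p 0).length + n) = k n := by
  let x : ℕ → ℕ := fun i => (p 0).getD i (k (i - (p 0).length))
  have hx : ∀ n, x ((p 0).length + n) = k n := fun n => by simp [x]
  have hseg : ∀ n, p n = seg x ((p 0).length + n) := by
    intro n
    induction n with
    | zero =>
      refine List.ext_getElem (by simp [seg]) fun i h _ => ?_
      simp [seg, x]
    | succ n ih => rw [hk, ← add_assoc, seg_succ, ← ih, hx]
  exact ⟨x, fun n => hT _ (hp n) _ (hseg n ▸ seg_isPrefix x (Nat.le_add_left _ _)), hseg, hx⟩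

/-- Any two Laver trees have `K`-related branches. -/
theorem IsLaverTree.exists_krel {T S : Set (List ℕ)} (hT : IsLaverTree T) (hS : IsLaverTree S) :
    ∃ x ∈ branches T, ∃ y ∈ branches S, Krel x y := by
  obtain ⟨hTc, s, hs⟩ := hT
  obtain ⟨hSc, u, hu⟩ := hS
  let P := {w : List ℕ × List ℕ // (w.1 ∈ T ∧ s <+: w.1) ∧ w.2 ∈ S ∧ u <+: w.2}
  have step : ∀ w : P, ∃ (w' : P) (k l : ℕ), w'.1.1 = w.1.1 ++ [k] ∧ w'.1.2 = w.1.2 ++ [l] ∧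
      (∀ z ∈ w.1.2, z ≤ k) ∧ ∀ z ∈ w'.1.1, z ≤ l := by
    rintro ⟨⟨p, q⟩, ⟨hp, hsp⟩, hq, huq⟩
    obtain ⟨k, hk, hqk⟩ := hs.exists_succ_ge hp hsp q
    obtain ⟨l, hl, hpl⟩ := hu.exists_succ_ge hq huq (p ++ [k])
    exact ⟨⟨(p ++ [k], q ++ [l]), ⟨hk, hsp.trans (List.prefix_append _ _)⟩, hl,
      huq.trans (List.prefix_append _ _)⟩, k, l, rfl, rfl, hqk, hpl⟩
  choose next k l hk hl hqk hpl using step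
  let w : ℕ → P := fun n =>
    next^[n] ⟨(s, u), ⟨hs.1, List.prefix_rfl⟩, hu.1, List.prefix_rfl⟩
  have hw : ∀ n, w (n + 1) = next (w n) := fun n => Function.iterate_succ_apply' next n _
  obtain ⟨x, hxT, hxseg, hxk⟩ := exists_branch_of_chain hTc (fun n => (w n).1.1)
    (fun n => k (w n)) (fun n => (w n).2.1.1) fun n => by simp only [hw, hk]
  obtain ⟨y, hyS, hyseg, hyl⟩ := exists_branch_of_chain hSc (fun n => (w n).1.2)
    (fun n => l (w n)) (fun n => (w n).2.2.1) fun n => by simp only [hw, hl]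
  refine ⟨x, hxT, y, hyS, s.length + u.length + 1, fun n =>
    ⟨s.length + 1, by omega, u.length, by omega, ?_, ?_⟩⟩
  · have hmem : x n ∈ (w (n + 1)).1.1 := by
      rw [hxseg]
      exact apply_mem_seg x (by omega)
    have hle := hpl (w n) (x n) (hw n ▸ hmem)
    rw [← hyl n, add_comm] at hle
    exact hle
  · have hmem : y n ∈ (w (n + 1)).1.2 := by
      rw [hyseg]
      exact apply_mem_seg y (by omega)
    have hle := hqk (w (n + 1)) (y n) hmem
    rw [← hxk (n + 1)] at hle
    rwa [show n + (s.length + 1) = s.length + (n + 1) by omega]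

/-- if `K ⊆ E` and the branches of Laver trees `T` and `S` each
lie in one `E`-class, those classes coincide. -/
theorem stmt19 (E : (ℕ → ℕ) → (ℕ → ℕ) → Prop) (hE : Equivalence E)
    (hK : ∀ x y, Krel x y → E x y)
    (T S : Set (List ℕ)) (hT : IsLaverTree T) (hS : IsLaverTree S)
    (hTclass : ∀ x ∈ branches T, ∀ y ∈ branches T, E x y)
    (hSclass : ∀ x ∈ branches S, ∀ y ∈ branches S, E x y) :
    ∀ x ∈ branches T, ∀ y ∈ branches S, E x y := by
  intro x hx y hy
  obtain ⟨x', hx', y', hy', hxy⟩ := hT.exists_krel hS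
  exact hE.trans (hTclass x hx x' hx') (hE.trans (hK x' y' hxy) (hSclass y' hy' y hy))
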